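/- Let N ≥ 3. There is no sequence (u_k) of smooth functions with compact support contained in ℝ^N \ {0} such that ∫_{ℝ^N} u_k(x)²/|x|² dx = 1 for all k, ∫_{ℝ^N} |∇u_k|² dx → (N−2)²/4, and (∇u_k) is a Cauchy sequence in L²(ℝ^N; ℝ^N). In other words, the sharp Hardy constant (N−2)²/4 is not attained in the space D^{1,2}(ℝ^N \ {0}) obtained by completing the smooth compactly supported functions in the gradient L² norm. -/

import Mathlib

open MeasureTheory Filter Topology

/-- The Dirichlet energy `∫ |∇u|²` of a function on `ℝᴺ`. -/
noncomputable def grad2 (N : ℕ) (u : EuclideanSpace ℝ (Fin N) → ℝ) : ℝ :=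
  ∫ x, ‖fderiv ℝ u x‖ ^ 2

/-- The weighted mass `∫ V u²`. -/
noncomputable def ven (N : ℕ) (V u : EuclideanSpace ℝ (Fin N) → ℝ) : ℝ :=
  ∫ x, V x * u x ^ 2

/-- A smooth test function with compact support contained in `Ω`. -/
def IsTest (N : ℕ) (Ω : Set (EuclideanSpace ℝ (Fin N)))
    (u : EuclideanSpace ℝ (Fin N) → ℝ) : Prop :=
  ContDiff ℝ (⊤ : ℕ∞) u ∧ HasCompactSupport u ∧ tsupport u ⊆ Ω

/-- The Rayleigh quotient infimum `μ_Ω`. -/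
noncomputable def mu (N : ℕ) (V : EuclideanSpace ℝ (Fin N) → ℝ)
    (Ω : Set (EuclideanSpace ℝ (Fin N))) : ℝ :=
  sInf {q : ℝ | ∃ u, IsTest N Ω u ∧ 0 < ven N V u ∧ q = grad2 N u / ven N V u}

/-- A normalized minimizing sequence for `μ_Ω`. -/
def MinimizingSeq (N : ℕ) (V : EuclideanSpace ℝ (Fin N) → ℝ)
    (Ω : Set (EuclideanSpace ℝ (Fin N)))
    (u : ℕ → EuclideanSpace ℝ (Fin N) → ℝ) : Prop :=
  (∀ k, IsTest N Ω (u k)) ∧ (∀ k, ven N V (u k) = 1) ∧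
    Tendsto (fun k => grad2 N (u k)) atTop (𝓝 (mu N V Ω))

/-- The gradients `∇u_k` form a Cauchy sequence in `L²(ℝᴺ; ℝᴺ)`. -/
def GradCauchy (N : ℕ) (u : ℕ → EuclideanSpace ℝ (Fin N) → ℝ) : Prop :=
  ∀ ε : ℝ, 0 < ε → ∃ M : ℕ, ∀ j ≥ M, ∀ l ≥ M,
    (∫ x, ‖fderiv ℝ (u j) x - fderiv ℝ (u l) x‖ ^ 2) < ε

/-- `V` is locally `L^p` on `X`. -/
def LocLp (N : ℕ) (p : ℝ) (V : EuclideanSpace ℝ (Fin N) → ℝ)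
    (X : Set (EuclideanSpace ℝ (Fin N))) : Prop :=
  ∀ K : Set (EuclideanSpace ℝ (Fin N)), IsCompact K → K ⊆ X →
    IntegrableOn (fun x => V x ^ p) K

/-- Euler's identity in integrated form: `div (h x) = Dh(x) x + N h` integrates to zero. -/
lemma integral_fderiv_apply_self {N : ℕ} {h : EuclideanSpace ℝ (Fin N) → ℝ}
    (hh : ContDiff ℝ 1 h) (hc : HasCompactSupport h) :
    ∫ x, fderiv ℝ h x x = -(N : ℝ) * ∫ x, h x := by
  have hd : Continuous (fderiv ℝ h) := hh.continuous_fderiv one_ne_zero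
  let e : Fin N → EuclideanSpace ℝ (Fin N) := fun i => EuclideanSpace.single i 1
  have hsum : ∀ x, fderiv ℝ h x x = ∑ i, x i * fderiv ℝ h x (e i) := by
    intro x
    have h := congrArg (fderiv ℝ h x) ((EuclideanSpace.basisFun (Fin N) ℝ).sum_repr x)
    rw [map_sum] at h
    simpa [e] using h.symm
  have hint : ∀ i, Integrable fun x => x i * fderiv ℝ h x (e i) := fun i =>
    Continuous.integrable_of_hasCompactSupport (by fun_prop)
      ((hc.fderiv_apply ℝ (e i)).mul_left (f := fun x : EuclideanSpace ℝ (Fin N) => x i))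
  have hcoord : ∀ (i : Fin N) (x : EuclideanSpace ℝ (Fin N)),
      HasFDerivAt (fun y : EuclideanSpace ℝ (Fin N) => y i)
        (EuclideanSpace.proj i : EuclideanSpace ℝ (Fin N) →L[ℝ] ℝ) x := fun i x =>
    (EuclideanSpace.proj i : EuclideanSpace ℝ (Fin N) →L[ℝ] ℝ).hasFDerivAt
  have hone : ∀ (i : Fin N) (x : EuclideanSpace ℝ (Fin N)),
      fderiv ℝ (fun y : EuclideanSpace ℝ (Fin N) => y i) x (e i) = 1 := by
    intro i x
    rw [(hcoord i x).fderiv]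
    simp [e]
  have hpart : ∀ i, ∫ x, x i * fderiv ℝ h x (e i) = -∫ x, h x := by
    intro i
    rw [integral_mul_fderiv_eq_neg_fderiv_mul_of_integrable _ (hint i)]
    · simp [hone]
    · exact Continuous.integrable_of_hasCompactSupport
        ((by fun_prop : Continuous fun x : EuclideanSpace ℝ (Fin N) => x i).mul hh.continuous)
        (hc.mul_left (f := fun x : EuclideanSpace ℝ (Fin N) => x i))
    · exact fun x _ => (hcoord i x).differentiableAt
    · exact fun x _ => hh.differentiable one_ne_zero x
    · simpa [hone] using hh.continuous.integrable_of_hasCompactSupport hc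
  simp_rw [hsum]
  rw [integral_finsetSum _ fun i _ => hint i]
  simp [hpart]

lemma integrable_of_support_subset {N : ℕ} {w g : EuclideanSpace ℝ (Fin N) → ℝ}
    (hc : HasCompactSupport w) (hg : Continuous g) (h : ∀ x, x ∉ tsupport w → g x = 0) :
    Integrable g :=
  hg.integrable_of_hasCompactSupport (HasCompactSupport.intro hc h)

lemma fderiv_eq_zero_of_notMem_tsupport {N : ℕ} {w : EuclideanSpace ℝ (Fin N) → ℝ}
    {x : EuclideanSpace ℝ (Fin N)} (hx : x ∉ tsupport w) : fderiv ℝ w x = 0 :=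
  image_eq_zero_of_notMem_tsupport fun h => hx (tsupport_fderiv_subset ℝ h)

section

variable {N : ℕ} {w : EuclideanSpace ℝ (Fin N) → ℝ}

lemma integral_weighted_sq (hw : ContDiff ℝ 1 w) (hc : HasCompactSupport w)
    {φ : EuclideanSpace ℝ (Fin N) → ℝ} (hφ : ContDiff ℝ 1 φ) :
    ∫ x, 2 * w x * (fderiv ℝ w x x + N / 2 * w x) * φ x = -∫ x, w x ^ 2 * fderiv ℝ φ x x := by
  have hdw : Continuous fun x => fderiv ℝ w x x :=
    (hw.continuous_fderiv one_ne_zero).clm_apply continuous_id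
  have hdφ : Continuous fun x => fderiv ℝ φ x x :=
    (hφ.continuous_fderiv one_ne_zero).clm_apply continuous_id
  have hwc := hw.continuous
  have hφc := hφ.continuous
  have hz : ∀ x, x ∉ tsupport w → w x = 0 := fun x hx => image_eq_zero_of_notMem_tsupport hx
  have key := integral_fderiv_apply_self (h := fun x => w x ^ 2 * φ x)
    ((hw.pow 2).mul hφ) (HasCompactSupport.intro hc fun x hx => by simp [hz x hx])
  have hder : ∀ x, fderiv ℝ (fun x => w x ^ 2 * φ x) x x =
      2 * w x * (fderiv ℝ w x x + N / 2 * w x) * φ x + w x ^ 2 * fderiv ℝ φ x x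
        - N * (w x ^ 2 * φ x) := by
    intro x
    have h1 := (hw.differentiable one_ne_zero x).hasFDerivAt
    have h2 := (hφ.differentiable one_ne_zero x).hasFDerivAt
    have h3 : fderiv ℝ (fun x => w x ^ 2 * φ x) x = _ := ((h1.pow 2).mul h2).fderiv
    rw [h3]
    simp
    ring
  simp_rw [hder] at key
  rw [integral_sub, integral_add, integral_const_mul] at key
  · linarith
  all_goals
    exact integrable_of_support_subset hc (by fun_prop) fun x hx => by simp [hz x hx]

lemma integral_sq_fderiv_apply_self_add (hw : ContDiff ℝ 1 w) (hc : HasCompactSupport w) :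
    ∫ x, (fderiv ℝ w x x + w x) ^ 2 =
      ((N : ℝ) - 2) ^ 2 / 4 * (∫ x, w x ^ 2) + ∫ x, (fderiv ℝ w x x + N / 2 * w x) ^ 2 := by
  have hdw : Continuous fun x => fderiv ℝ w x x :=
    (hw.continuous_fderiv one_ne_zero).clm_apply continuous_id
  have hwc := hw.continuous
  have hz : ∀ x, x ∉ tsupport w → w x = 0 := fun x hx => image_eq_zero_of_notMem_tsupport hx
  have hz' : ∀ x, x ∉ tsupport w → fderiv ℝ w x = 0 := fun x hx =>
    fderiv_eq_zero_of_notMem_tsupport hx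
  have key := integral_weighted_sq hw hc (φ := fun _ => 1) contDiff_const
  simp only [mul_one, fderiv_fun_const, Pi.zero_apply, zero_apply, mul_zero,
    integral_zero, neg_zero] at key
  have hpt : ∀ x, (fderiv ℝ w x x + w x) ^ 2 = ((N : ℝ) - 2) ^ 2 / 4 * w x ^ 2
      + (fderiv ℝ w x x + N / 2 * w x) ^ 2
      - ((N : ℝ) - 2) / 2 * (2 * w x * (fderiv ℝ w x x + N / 2 * w x)) := fun x => by ring
  simp_rw [hpt]
  rw [integral_sub, integral_add, integral_const_mul, integral_const_mul, key]
  · ring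
  all_goals
    exact integrable_of_support_subset hc (by fun_prop) fun x hx => by simp [hz x hx, hz' x hx]

lemma integral_sq_mul_le (hw : ContDiff ℝ 1 w) (hc : HasCompactSupport w) {δ : ℝ} (hδ : 0 < δ) :
    ∫ x, w x ^ 2 * (2 * ‖x‖ ^ 2 / (1 + ‖x‖ ^ 2) ^ 2) ≤
      δ * (∫ x, w x ^ 2) + δ⁻¹ * ∫ x, (fderiv ℝ w x x + N / 2 * w x) ^ 2 := by
  have hdw : Continuous fun x => fderiv ℝ w x x :=
    (hw.continuous_fderiv one_ne_zero).clm_apply continuous_id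
  have hwc := hw.continuous
  have hz : ∀ x, x ∉ tsupport w → w x = 0 := fun x hx => image_eq_zero_of_notMem_tsupport hx
  have hz' : ∀ x, x ∉ tsupport w → fderiv ℝ w x = 0 := fun x hx =>
    fderiv_eq_zero_of_notMem_tsupport hx
  have hpos : ∀ x : EuclideanSpace ℝ (Fin N), 0 < 1 + ‖x‖ ^ 2 := fun x => by positivity
  have hne : ∀ x : EuclideanSpace ℝ (Fin N), 1 + ‖x‖ ^ 2 ≠ 0 := fun x => (hpos x).ne'
  have hφ : ContDiff ℝ 1 fun x : EuclideanSpace ℝ (Fin N) => (1 + ‖x‖ ^ 2)⁻¹ :=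
    (contDiff_const.add (contDiff_norm_sq ℝ)).inv hne
  have hφc := hφ.continuous
  have hder : ∀ x : EuclideanSpace ℝ (Fin N),
      fderiv ℝ (fun x : EuclideanSpace ℝ (Fin N) => (1 + ‖x‖ ^ 2)⁻¹) x x =
        -(2 * ‖x‖ ^ 2 / (1 + ‖x‖ ^ 2) ^ 2) := by
    intro x
    have h1 := ((hasFDerivAt_id (𝕜 := ℝ) x).norm_sq).const_add 1
    have h2 := (hasDerivAt_inv (hne x)).comp_hasFDerivAt x h1
    have h3 : fderiv ℝ (fun x : EuclideanSpace ℝ (Fin N) => (1 + ‖x‖ ^ 2)⁻¹) x = _ := h2.fderiv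
    rw [h3]
    simp
    ring
  have key := integral_weighted_sq hw hc hφ
  simp_rw [hder, mul_neg] at key
  rw [integral_neg, neg_neg] at key
  rw [← key, ← integral_const_mul, ← integral_const_mul, ← integral_add]
  · refine integral_mono ?_ ?_ fun x => ?_
    · exact integrable_of_support_subset hc (by fun_prop) fun x hx => by simp [hz x hx]
    · exact integrable_of_support_subset hc (by fun_prop) fun x hx => by simp [hz x hx, hz' x hx]
    · have hle : (1 + ‖x‖ ^ 2)⁻¹ ≤ 1 := inv_le_one_of_one_le₀ (by nlinarith [sq_nonneg ‖x‖])
      have hnn : 0 ≤ (1 + ‖x‖ ^ 2)⁻¹ := (inv_pos.2 (hpos x)).le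
      generalize (1 + ‖x‖ ^ 2)⁻¹ = p at *
      generalize fderiv ℝ w x x + N / 2 * w x = r
      generalize w x = s
      have hid : δ * s ^ 2 + δ⁻¹ * r ^ 2 - 2 * s * r = δ⁻¹ * (δ * s - r) ^ 2 := by
        field_simp
        ring
      have h1 : 0 ≤ δ * s ^ 2 + δ⁻¹ * r ^ 2 - 2 * s * r := by rw [hid]; positivity
      have h2 : 0 ≤ δ * s ^ 2 + δ⁻¹ * r ^ 2 := by positivity
      change 2 * s * r * p ≤ δ * s ^ 2 + δ⁻¹ * r ^ 2
      nlinarith [mul_nonneg h1 hnn, mul_nonneg h2 (sub_nonneg.2 hle)]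
  all_goals
    exact integrable_of_support_subset hc (by fun_prop) fun x hx => by simp [hz x hx, hz' x hx]

end

section

variable {N : ℕ} {u : EuclideanSpace ℝ (Fin N) → ℝ}

lemma tsupport_div_norm_subset : tsupport (fun x => u x / ‖x‖) ⊆ tsupport u :=
  closure_mono fun x hx => by
    simp only [Function.mem_support] at hx ⊢
    exact fun h => hx (by simp [h])

lemma IsTest.div_norm (hu : IsTest N {x | x ≠ 0} u) :
    ContDiff ℝ 1 (fun x => u x / ‖x‖) ∧ HasCompactSupport fun x => u x / ‖x‖ := by
  obtain ⟨hs, hc, h0⟩ := hu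
  refine ⟨contDiff_iff_contDiffAt.2 fun x => ?_, HasCompactSupport.intro hc fun x hx => by
    simp [image_eq_zero_of_notMem_tsupport hx]⟩
  by_cases hx : x ∈ tsupport u
  · have hx0 : x ≠ 0 := h0 hx
    exact ((hs.of_le (by exact_mod_cast le_top)).contDiffAt).div (contDiffAt_norm ℝ hx0)
      (norm_ne_zero_iff.2 hx0)
  · have : (fun x => u x / ‖x‖) =ᶠ[𝓝 x] fun _ => 0 :=
      notMem_tsupport_iff_eventuallyEq.1 fun h => hx (tsupport_div_norm_subset h)
    exact contDiffAt_const.congr_of_eventuallyEq this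

lemma IsTest.sq_le_norm_fderiv_sq (hu : IsTest N {x | x ≠ 0} u) (x : EuclideanSpace ℝ (Fin N)) :
    (fderiv ℝ (fun x => u x / ‖x‖) x x + u x / ‖x‖) ^ 2 ≤ ‖fderiv ℝ u x‖ ^ 2 := by
  by_cases hx : x = 0
  · subst hx
    simp
  have hn : 0 < ‖x‖ := norm_pos_iff.2 hx
  have hw := (hu.div_norm.1.differentiable one_ne_zero x).hasFDerivAt
  have hnorm := ((contDiffAt_norm ℝ hx (n := 1)).differentiableAt one_ne_zero).hasFDerivAt
  have heq : u = fun y => u y / ‖y‖ * ‖y‖ := by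
    funext y
    by_cases hy : y = 0
    · subst hy
      simpa using image_eq_zero_of_notMem_tsupport fun h => hu.2.2 h rfl
    · rw [div_mul_cancel₀ _ (norm_ne_zero_iff.2 hy)]
  have hder : fderiv ℝ u x x = ‖x‖ * (fderiv ℝ (fun x => u x / ‖x‖) x x + u x / ‖x‖) := by
    have hprod : fderiv ℝ (fun y => u y / ‖y‖ * ‖y‖) x = _ := (hw.mul hnorm).fderiv
    conv_lhs => rw [heq, hprod]
    have : fderiv ℝ norm x x = ‖x‖ := hnorm.differentiableAt.fderiv_norm_self
    simp [this]
    ring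
  have hle := (fderiv ℝ u x).le_opNorm x
  rw [hder, norm_mul, norm_norm, mul_comm] at hle
  rw [← sq_abs]
  exact pow_le_pow_left₀ (abs_nonneg _) (le_of_mul_le_mul_right hle hn) 2

/-- The Hardy inequality with its radial remainder term. -/
lemma IsTest.hardy_remainder (hu : IsTest N {x | x ≠ 0} u) :
    ((N : ℝ) - 2) ^ 2 / 4 * (∫ x, (u x / ‖x‖) ^ 2) +
      ∫ x, (fderiv ℝ (fun x => u x / ‖x‖) x x + N / 2 * (u x / ‖x‖)) ^ 2 ≤
        ∫ x, ‖fderiv ℝ u x‖ ^ 2 := by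
  obtain ⟨hw, hc⟩ := hu.div_norm
  rw [← integral_sq_fderiv_apply_self_add hw hc]
  have hdw : Continuous fun x => fderiv ℝ (fun x => u x / ‖x‖) x x :=
    (hw.continuous_fderiv one_ne_zero).clm_apply continuous_id
  have hwc := hw.continuous
  have hdu : Continuous (fderiv ℝ u) := hu.1.continuous_fderiv (by simp)
  refine integral_mono ?_ ?_ hu.sq_le_norm_fderiv_sq
  · refine integrable_of_support_subset hc (by fun_prop) fun x hx => ?_
    have h0 : u x / ‖x‖ = 0 :=
      image_eq_zero_of_notMem_tsupport (f := fun x => u x / ‖x‖) hx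
    simp [h0, fderiv_eq_zero_of_notMem_tsupport hx]
  · exact integrable_of_support_subset hu.2.1 (by fun_prop) fun x hx => by
      simp [fderiv_eq_zero_of_notMem_tsupport hx]

/-- A test function supported away from the origin sees the weight `2 r² / (1 + r²)²` bounded
below. -/
lemma IsTest.exists_weight_bound (hu : IsTest N {x | x ≠ 0} u) :
    ∃ C > 0, ∀ x ∈ tsupport u, 1 ≤ C * (2 * ‖x‖ ^ 2 / (1 + ‖x‖ ^ 2) ^ 2) := by
  have hcont : ContinuousOn (fun x : EuclideanSpace ℝ (Fin N) =>
      (1 + ‖x‖ ^ 2) ^ 2 / (2 * ‖x‖ ^ 2)) (tsupport u) := by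
    refine ContinuousOn.div (by fun_prop) (by fun_prop) fun x hx => ?_
    have : x ≠ 0 := hu.2.2 hx
    simpa using this
  obtain ⟨C, hC⟩ := hu.2.1.exists_bound_of_continuousOn hcont
  refine ⟨max C 1, by positivity, fun x hx => ?_⟩
  have hx0 : 0 < ‖x‖ := norm_pos_iff.2 (hu.2.2 hx)
  have h := (le_abs_self _).trans ((hC x hx).trans (le_max_left C 1))
  rw [div_le_iff₀ (by positivity)] at h
  rw [mul_div_assoc', le_div_iff₀ (by positivity), one_mul]
  exact h

end

/-- **Non-attainment of the Hardy constant.** There is no normalized minimizing sequence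
for the Hardy quotient whose gradients are Cauchy in `L²`: the constant `(N−2)²/4` is not
attained in `D^{1,2}(ℝᴺ \ {0})`. -/
theorem hardy_constant_not_attained
    (N : ℕ) (hN : 3 ≤ N) :
    ¬ ∃ u : ℕ → EuclideanSpace ℝ (Fin N) → ℝ,
      (∀ k, ContDiff ℝ (⊤ : ℕ∞) (u k) ∧ HasCompactSupport (u k) ∧
        tsupport (u k) ⊆ {x : EuclideanSpace ℝ (Fin N) | x ≠ 0}) ∧
      (∀ k, (∫ x, u k x ^ 2 / ‖x‖ ^ 2) = 1) ∧
      Tendsto (fun k => ∫ x, ‖fderiv ℝ (u k) x‖ ^ 2) atTop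
        (𝓝 (((N : ℝ) - 2) ^ 2 / 4)) ∧
      GradCauchy N u := by
  rintro ⟨u, htest, hnorm, hlim, hcauchy⟩
  replace htest : ∀ k, IsTest N {x | x ≠ 0} (u k) := htest
  simp_rw [← div_pow] at hnorm
  have hN' : (3 : ℝ) ≤ N := by exact_mod_cast hN
  have ha : 0 < ((N : ℝ) - 2) ^ 2 / 4 := by
    have : 0 < (N : ℝ) - 2 := by linarith
    positivity
  set A := ((N : ℝ) - 2) ^ 2 / 4 with hA
  obtain ⟨M, hM⟩ := hcauchy (A / 16) (by positivity)
  obtain ⟨C, hC, hCb⟩ := (htest M).exists_weight_bound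
  obtain ⟨δ, hδ, hδC⟩ : ∃ δ > 0, C * δ = 1 / 8 := ⟨1 / (8 * C), by positivity, by field_simp⟩
  obtain ⟨j, hj, hjM⟩ := ((hlim.eventually_lt_const (u := A + δ ^ 2) (by
    linarith [pow_pos hδ 2])).and (eventually_ge_atTop M)).exists
  have hdiff : IsTest N {x | x ≠ 0} (fun x => u j x - u M x) := by
    refine ⟨(htest j).1.sub (htest M).1, (htest j).2.1.sub (htest M).2.1, ?_⟩
    exact (tsupport_sub _ _).trans (Set.union_subset (htest j).2.2 (htest M).2.2)
  have hclose : ∫ x, ((u j x - u M x) / ‖x‖) ^ 2 ≤ 1 / 16 := by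
    have h1 := hdiff.hardy_remainder
    have h2 := hM j hjM M le_rfl
    have hd : ∀ x, fderiv ℝ (fun x => u j x - u M x) x = fderiv ℝ (u j) x - fderiv ℝ (u M) x :=
      fun x => fderiv_fun_sub ((htest j).1.differentiable (by simp) x)
        ((htest M).1.differentiable (by simp) x)
    simp_rw [hd] at h1
    rw [← hA] at h1
    have h3 : 0 ≤ ∫ x, (fderiv ℝ (fun x => (u j x - u M x) / ‖x‖) x x +
        N / 2 * ((u j x - u M x) / ‖x‖)) ^ 2 := integral_nonneg fun x => sq_nonneg _
    refine le_of_mul_le_mul_left ?_ ha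
    linarith
  have hsmall : ∫ x, (u j x / ‖x‖) ^ 2 * (2 * ‖x‖ ^ 2 / (1 + ‖x‖ ^ 2) ^ 2) ≤ 2 * δ := by
    have h1 := (htest j).hardy_remainder
    have h2 := integral_sq_mul_le (htest j).div_norm.1 (htest j).div_norm.2 hδ
    rw [hnorm j] at h1 h2
    rw [← hA] at h1
    have h3 : δ⁻¹ * ∫ x, (fderiv ℝ (fun x => u j x / ‖x‖) x x + N / 2 * (u j x / ‖x‖)) ^ 2
        ≤ δ⁻¹ * δ ^ 2 := by gcongr; linarith
    have h4 : δ⁻¹ * δ ^ 2 = δ := by field_simp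
    linarith
  have hpt : ∀ x, (u M x / ‖x‖) ^ 2 ≤ 2 * ((u j x - u M x) / ‖x‖) ^ 2 +
      2 * C * ((u j x / ‖x‖) ^ 2 * (2 * ‖x‖ ^ 2 / (1 + ‖x‖ ^ 2) ^ 2)) := by
    intro x
    by_cases hx : x ∈ tsupport (u M)
    · have h1 := mul_le_mul_of_nonneg_left (hCb x hx) (sq_nonneg (u j x / ‖x‖))
      rw [sub_div]
      nlinarith [sq_nonneg (2 * (u j x / ‖x‖) - u M x / ‖x‖)]
    · rw [image_eq_zero_of_notMem_tsupport hx]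
      simp only [zero_div, ne_eq, OfNat.ofNat_ne_zero, not_false_eq_true, zero_pow]
      positivity
  have hsq : ∀ {v : EuclideanSpace ℝ (Fin N) → ℝ}, IsTest N {x | x ≠ 0} v →
      ∀ g : EuclideanSpace ℝ (Fin N) → ℝ, Continuous g →
        Integrable fun x => (v x / ‖x‖) ^ 2 * g x := fun {v} hv g hg =>
    integrable_of_support_subset hv.2.1 ((hv.div_norm.1.continuous.pow 2).mul hg) fun x hx => by
      simp [image_eq_zero_of_notMem_tsupport hx]
  have hone : ∀ {v : EuclideanSpace ℝ (Fin N) → ℝ}, IsTest N {x | x ≠ 0} v →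
      Integrable fun x => (v x / ‖x‖) ^ 2 := fun hv => by
    simpa using hsq hv (fun _ => 1) continuous_const
  have hweight : Continuous fun x : EuclideanSpace ℝ (Fin N) =>
      2 * ‖x‖ ^ 2 / (1 + ‖x‖ ^ 2) ^ 2 :=
    Continuous.div (by fun_prop) (by fun_prop) fun x => by positivity
  have i1 := (hone hdiff).const_mul 2
  have i2 := (hsq (htest j) _ hweight).const_mul (2 * C)
  have hfinal := integral_mono (hone (htest M)) (i1.add i2) hpt
  simp only [Pi.add_apply] at hfinal
  rw [hnorm M, integral_add i1 i2, integral_const_mul, integral_const_mul] at hfinal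
  have := mul_le_mul_of_nonneg_left hsmall (by positivity : 0 ≤ 2 * C)
  nlinarith
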